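/- Let m ≥ 2 and let f, g be m-homogeneous complex polynomials in two variables that are nondegenerate, i.e. f(x,y) = g(x,y) = 0 implies (x,y) = (0,0). Set f₁(z) := f(1,z), g₁(z) := g(1,z), and P(z) := −z·f₁(z) + g₁(z), and let e be a simple zero of P. Then: (a) (u,z) = (0,e) is an equilibrium of the blow-up system du/dt₁ = −u·f₁(z), dz/dt₁ = P(z); (b) the linearization there is diagonal, with eigenvalues λ₁ = −f₁(e) ≠ 0 and λ₂ = P′(e) ≠ 0; (c) the holonomy of u over loops around z = e is linear, with holonomy multiplier exp(2πiλ) for the spectral quotient λ = −f₁(e)/P′(e); and (d) if either λ < 0 (Siegel saddle type) or λ > 0 with λ, 1/λ ∉ ℕ \ {1} (nonresonant Poincaré node type), then the system is locally analytically orbitally equivalent to its diagonal linearization u̇ = λ₁u, ż = λ₂z near (0,e). -/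

import Mathlib

open Metric

/-- Evaluation of a polynomial in two variables at `(x, y)`. -/
noncomputable def evP (p : MvPolynomial (Fin 2) ℂ) (x y : ℂ) : ℂ :=
  MvPolynomial.eval ![x, y] p

/-- Winding number (as a complex number) of a differentiable closed path
`γ : [0,1] → ℂ` around a point `p`. -/
noncomputable def wnd (γ : ℝ → ℂ) (p : ℂ) : ℂ :=
  (2 * (Real.pi : ℂ) * Complex.I)⁻¹ * ∫ s in (0:ℝ)..1, deriv γ s / (γ s - p)

theorem evP_diff (p : MvPolynomial (Fin 2) ℂ) : Differentiable ℂ (fun z => evP p 1 z) := by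
  unfold evP
  induction p using MvPolynomial.induction_on with
  | C a => simp
  | add p q hp hq => simp only [map_add]; exact hp.add hq
  | mul_X p i hp =>
    simp only [map_mul, MvPolynomial.eval_X]
    refine hp.mul ?_
    fin_cases i
    · simp
    · simp

theorem key_factor (F P : ℂ → ℂ) (hF : Differentiable ℂ F) (hPd : Differentiable ℂ P)
    (e : ℂ) (he : P e = 0) (he' : deriv P e ≠ 0) (r : ℝ) (hr : 0 < r)
    (hz : ∀ w ∈ ball e r, P w = 0 → w = e) :
    ∃ Q h H : ℂ → ℂ, Differentiable ℂ Q ∧ Q e = deriv P e ∧ (∀ z ∈ ball e r, Q z ≠ 0) ∧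
      (∀ z, P z = (z - e) * Q z) ∧
      (∀ z ∈ ball e r, HasDerivAt H (h z) z) ∧
      (∀ z ∈ ball e r, -F z = Q z * (-(F e) / deriv P e + (z - e) * h z)) := by
  have hQd : Differentiable ℂ (dslope P e) := by
    rw [← differentiableOn_univ] at hPd ⊢
    exact (Complex.differentiableOn_dslope Filter.univ_mem).2 hPd
  have hPQ : ∀ z, P z = (z - e) * dslope P e z := by
    intro z
    have := sub_smul_dslope P e z
    rw [he, sub_zero, smul_eq_mul] at this
    exact this.symm
  have hQ0 : ∀ z ∈ ball e r, dslope P e z ≠ 0 := by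
    intro z hzb h0
    have h1 : z = e := hz z hzb (by rw [hPQ, h0, mul_zero])
    rw [h1, dslope_same] at h0
    exact he' h0
  have hk : DifferentiableOn ℂ (fun z => -F z / dslope P e z) (ball e r) :=
    hF.neg.differentiableOn.div hQd.differentiableOn hQ0
  have hh := (Complex.differentiableOn_dslope (ball_mem_nhds e hr)).2 hk
  obtain ⟨H, hH⟩ := hh.isExactOn_ball
  refine ⟨dslope P e, _, H, hQd, dslope_same _ _, hQ0, hPQ, hH, ?_⟩
  intro z hzb
  have := sub_smul_dslope (fun z => -F z / dslope P e z) e z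
  rw [smul_eq_mul] at this
  rw [this, dslope_same]
  have := hQ0 z hzb
  field_simp
  ring

/-- blow-up equilibria of nondegenerate `m`-homogeneous systems:
diagonal linearization with eigenvalues `λ₁ = −f₁(e) ≠ 0`, `λ₂ = P′(e) ≠ 0`,
linear holonomy with multiplier `exp(2πiλ)`, `λ = −f₁(e)/P′(e)`, and local
analytic orbital diagonalization in the Siegel saddle and nonresonant
Poincaré node cases. -/
theorem homogeneous_blowup_equilibria
    (m : ℕ) (hm : 2 ≤ m) (f g : MvPolynomial (Fin 2) ℂ)
    (hfhom : f.IsHomogeneous m) (hghom : g.IsHomogeneous m)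
    (hnd : ∀ x y : ℂ, evP f x y = 0 → evP g x y = 0 → x = 0 ∧ y = 0)
    (f1 g1 P : ℂ → ℂ)
    (hf1 : ∀ z, f1 z = evP f 1 z) (hg1 : ∀ z, g1 z = evP g 1 z)
    (hP : ∀ z, P z = -z * f1 z + g1 z)
    (e : ℂ) (he : P e = 0) (he' : deriv P e ≠ 0)
    (Φ : ℂ × ℂ → ℂ × ℂ)
    (hΦ : ∀ p : ℂ × ℂ, Φ p = (-(p.1 * f1 p.2), P p.2)) :
    -- (a) (0,e) is an equilibrium
    Φ (0, e) = (0, 0) ∧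
    -- (b) diagonal linearization with nonzero eigenvalues
    f1 e ≠ 0 ∧
    (∀ p : ℂ × ℂ, fderiv ℂ Φ (0, e) p = (-(f1 e) * p.1, deriv P e * p.2)) ∧
    -- (c) linear holonomy of u over loops around z = e, with multiplier
    --     exp(2πiλ), λ = −f₁(e)/P′(e)
    (∀ r : ℝ, 0 < r → (∀ w ∈ ball e r, P w = 0 → w = e) →
      ∀ γ dγ u : ℝ → ℂ,
        (∀ s ∈ Set.Icc (0:ℝ) 1, HasDerivAt γ (dγ s) s) →
        ContinuousOn dγ (Set.Icc 0 1) →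
        (∀ s ∈ Set.Icc (0:ℝ) 1, γ s ∈ ball e r ∧ γ s ≠ e) →
        γ 0 = γ 1 → wnd γ e = 1 →
        (∀ s ∈ Set.Icc (0:ℝ) 1,
          HasDerivAt u (-(u s) * f1 (γ s) * dγ s / P (γ s)) s) →
        u 1 = Complex.exp (2 * (Real.pi : ℂ) * Complex.I *
          (-(f1 e) / deriv P e)) * u 0) ∧
    -- (d) analytic orbital linearization for Siegel saddles and
    --     nonresonant Poincaré nodes
    (((∃ ρ : ℝ, ρ < 0 ∧ -(f1 e) / deriv P e = (ρ : ℂ)) ∨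
      (∃ ρ : ℝ, 0 < ρ ∧ -(f1 e) / deriv P e = (ρ : ℂ) ∧
        (¬ ∃ k : ℕ, 2 ≤ k ∧ -(f1 e) / deriv P e = (k : ℂ)) ∧
        (¬ ∃ k : ℕ, 2 ≤ k ∧ (-(f1 e) / deriv P e)⁻¹ = (k : ℂ)))) →
      ∃ (V W : Set (ℂ × ℂ)) (Ψ Ξ : ℂ × ℂ → ℂ × ℂ) (μ : ℂ × ℂ → ℂ),
        IsOpen V ∧ IsOpen W ∧ (0, 0) ∈ V ∧ ((0 : ℂ), e) ∈ W ∧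
        DifferentiableOn ℂ Ψ V ∧ DifferentiableOn ℂ Ξ W ∧
        Set.BijOn Ψ V W ∧ (∀ p ∈ V, Ξ (Ψ p) = p) ∧ (∀ q ∈ W, Ψ (Ξ q) = q) ∧
        Ψ (0, 0) = ((0 : ℂ), e) ∧
        DifferentiableOn ℂ μ V ∧ (∀ p ∈ V, μ p ≠ 0) ∧
        (∀ p ∈ V, fderiv ℂ Ψ p (-(f1 e) * p.1, deriv P e * p.2)
          = μ p • Φ (Ψ p))) := by
  have hf1d : Differentiable ℂ f1 := by
    rw [show f1 = fun z => evP f 1 z from funext hf1]; exact evP_diff f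
  have hg1d : Differentiable ℂ g1 := by
    rw [show g1 = fun z => evP g 1 z from funext hg1]; exact evP_diff g
  have hPd : Differentiable ℂ P := by
    rw [show P = fun z => -z * f1 z + g1 z from funext hP]
    exact (differentiable_id.neg.mul hf1d).add hg1d
  have hfe : f1 e ≠ 0 := by
    intro h0
    have h1 : g1 e = 0 := by
      have := hP e
      rw [he, h0] at this
      simpa using this.symm
    have := (hnd 1 e (by rw [← hf1, h0]) (by rw [← hg1, h1])).1
    exact one_ne_zero this
  refine ⟨by simp [hΦ, he], hfe, ?_, ?_, ?_⟩
  · intro p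
    have hΦ' : Φ = fun p : ℂ × ℂ => (-(p.1 * f1 p.2), P p.2) := funext hΦ
    have h1 : HasFDerivAt (fun p : ℂ × ℂ => f1 p.2) _ ((0 : ℂ), e) :=
      (hf1d e).hasDerivAt.comp_hasFDerivAt ((0 : ℂ), e)
        (hasFDerivAt_snd (𝕜 := ℂ) (E := ℂ) (F := ℂ) (p := ((0 : ℂ), e)))
    have h2 : HasFDerivAt (fun p : ℂ × ℂ => P p.2) _ ((0 : ℂ), e) :=
      (hPd e).hasDerivAt.comp_hasFDerivAt ((0 : ℂ), e)
        (hasFDerivAt_snd (𝕜 := ℂ) (E := ℂ) (F := ℂ) (p := ((0 : ℂ), e)))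
    have h3 := ((hasFDerivAt_fst (𝕜 := ℂ) (p := ((0 : ℂ), e))).mul h1).neg.prodMk h2
    have h4 : HasFDerivAt (fun p : ℂ × ℂ => (-(p.1 * f1 p.2), P p.2)) _ ((0 : ℂ), e) := h3
    rw [hΦ', h4.fderiv]
    simp
  · intro r hr hz γ dγ u hγ hdγ hmem hloop hw hu
    obtain ⟨Q, h, H, hQd, hQe, hQ0, hPQ, hH, hk⟩ :=
      key_factor f1 P hf1d hPd e he he' r hr hz
    set lam := -(f1 e) / deriv P e with hlam
    have hγc : ContinuousOn γ (Set.Icc 0 1) :=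
      fun s hs => (hγ s hs).continuousAt.continuousWithinAt
    have hqc : ContinuousOn (fun s => dγ s / (γ s - e)) (Set.Icc 0 1) :=
      hdγ.div (hγc.sub continuousOn_const) (fun s hs => sub_ne_zero.2 (hmem s hs).2)
    have hJ : ∀ s ∈ Set.Icc (0:ℝ) 1,
        HasDerivWithinAt (fun s => ∫ x in (0:ℝ)..s, dγ x / (γ x - e))
          (dγ s / (γ s - e)) (Set.Icc 0 1) s := by
      intro s hs
      have := Fact.mk hs
      apply intervalIntegral.integral_hasDerivWithinAt_right
      · exact (hqc.mono (Set.Icc_subset_Icc le_rfl hs.2)).intervalIntegrable_of_Icc hs.1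
      · exact hqc.stronglyMeasurableAtFilter_nhdsWithin measurableSet_Icc s
      · exact hqc.continuousWithinAt hs
    set J : ℝ → ℂ := fun s => ∫ x in (0:ℝ)..s, dγ x / (γ x - e) with hJdef
    have hJ1 : J 1 = 2 * (Real.pi : ℂ) * Complex.I := by
      have h1 : J 1 = ∫ s in (0:ℝ)..1, deriv γ s / (γ s - e) := by
        apply intervalIntegral.integral_congr
        intro s hs
        rw [Set.uIcc_of_le zero_le_one] at hs
        simp only [(hγ s hs).deriv]
      have hne := Complex.two_pi_I_ne_zero
      rw [wnd, ← h1, inv_mul_eq_iff_eq_mul₀ hne, mul_one] at hw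
      exact hw
    have hJ0 : J 0 = 0 := by simp [hJdef]
    have hv : ∀ s ∈ Set.Icc (0:ℝ) 1, HasDerivWithinAt
        (fun s => u s * Complex.exp (-(H (γ s) + lam * J s))) 0 (Set.Icc 0 1) s := by
      intro s hs
      have a1 : HasDerivAt (fun s => H (γ s)) (h (γ s) * dγ s) s :=
        (hH _ (hmem s hs).1).comp s (hγ s hs)
      have a2 := ((a1.hasDerivWithinAt (s := Set.Icc 0 1)).add
        ((hJ s hs).const_mul lam)).neg.cexp
      have a3 := ((hu s hs).hasDerivWithinAt (s := Set.Icc 0 1)).mul a2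
      refine a3.congr_deriv ?_
      have b1 := hQ0 _ (hmem s hs).1
      have b2 := sub_ne_zero.2 (hmem s hs).2
      have b3 : -(u s) * f1 (γ s) * dγ s / P (γ s)
          = u s * (lam * (dγ s / (γ s - e)) + h (γ s) * dγ s) := by
        rw [hPQ, neg_mul, ← mul_neg, hk _ (hmem s hs).1]
        field_simp
      rw [b3]
      simp only [Pi.add_apply, Pi.neg_apply]
      ring
    have hc := constant_of_derivWithin_zero (fun s hs => (hv s hs).differentiableWithinAt)
      (fun s hs => (hv s (Set.Ico_subset_Icc_self hs)).derivWithin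
        (uniqueDiffOn_Icc zero_lt_one s (Set.Ico_subset_Icc_self hs)))
      1 (Set.right_mem_Icc.2 zero_le_one)
    simp only [hJ1, hJ0, ← hloop, mul_zero, add_zero] at hc
    have e1 := Complex.exp_ne_zero (-(H (γ 0)))
    have e2 : Complex.exp (2 * (Real.pi : ℂ) * Complex.I * lam) *
        Complex.exp (-(lam * (2 * (Real.pi : ℂ) * Complex.I))) = 1 := by
      rw [← Complex.exp_add, ← Complex.exp_zero]; congr 1; ring
    rw [neg_add, Complex.exp_add] at hc
    apply mul_right_cancel₀ e1
    linear_combination Complex.exp (2 * (Real.pi : ℂ) * Complex.I * lam) * hc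
      - u 1 * Complex.exp (-(H (γ 0))) * e2
  · intro _
    obtain ⟨r, hr, hz⟩ : ∃ r > 0, ∀ w ∈ ball e r, P w = 0 → w = e := by
      have := (hPd e).hasDerivAt.eventually_ne (c := 0) he'
      rw [eventually_nhdsWithin_iff, Metric.eventually_nhds_iff_ball] at this
      obtain ⟨r, hr, h⟩ := this
      refine ⟨r, hr, fun w hw h0 => ?_⟩
      by_contra hne
      exact h w hw hne h0
    obtain ⟨Q, h, H, hQd, hQe, hQ0, hPQ, hH, hk⟩ :=
      key_factor f1 P hf1d hPd e he he' r hr hz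
    have hsh : ∀ w : ℂ, w ∈ ball (0 : ℂ) r ↔ e + w ∈ ball e r := by
      intro w; simp [mem_ball, dist_eq_norm]
    have hΨ : ∀ p ∈ (Set.univ : Set ℂ) ×ˢ ball (0 : ℂ) r, HasFDerivAt
        (fun p : ℂ × ℂ => (p.1 * Complex.exp (H (e + p.2)), e + p.2))
        ((p.1 • (Complex.exp (H (e + p.2)) • (h (e + p.2) • ContinuousLinearMap.snd ℂ ℂ ℂ)) +
          Complex.exp (H (e + p.2)) • ContinuousLinearMap.fst ℂ ℂ ℂ).prod
          (ContinuousLinearMap.snd ℂ ℂ ℂ)) p := by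
      intro p hp
      have c0 : HasFDerivAt (fun p : ℂ × ℂ => e + p.2) (ContinuousLinearMap.snd ℂ ℂ ℂ) p :=
        hasFDerivAt_snd.const_add e
      have c1 : HasFDerivAt (fun p : ℂ × ℂ => H (e + p.2)) _ p :=
        (hH _ ((hsh _).1 hp.2)).comp_hasFDerivAt p c0
      exact (hasFDerivAt_fst.mul c1.cexp).prodMk c0
    refine ⟨Set.univ ×ˢ ball (0 : ℂ) r, Set.univ ×ˢ ball e r,
      fun p => (p.1 * Complex.exp (H (e + p.2)), e + p.2),
      fun q => (q.1 * Complex.exp (-(H q.2)), q.2 - e),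
      fun p => deriv P e / Q (e + p.2),
      isOpen_univ.prod isOpen_ball, isOpen_univ.prod isOpen_ball,
      ⟨trivial, mem_ball_self hr⟩, ⟨trivial, mem_ball_self hr⟩,
      fun p hp => (hΨ p hp).differentiableAt.differentiableWithinAt, ?_, ?_, ?_, ?_, ?_, ?_, ?_, ?_⟩
    · intro q hq
      have c1 : DifferentiableAt ℂ (fun q : ℂ × ℂ => H q.2) q :=
        (hH _ hq.2).differentiableAt.comp q differentiableAt_snd
      exact ((differentiableAt_fst.mul c1.neg.cexp).prodMk
        (differentiableAt_snd.sub_const e)).differentiableWithinAt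
    · refine Set.InvOn.bijOn (f' := fun q : ℂ × ℂ => (q.1 * Complex.exp (-(H q.2)), q.2 - e))
        ⟨?_, ?_⟩ ?_ ?_
      · intro p hp
        ext
        · simp [mul_assoc, ← Complex.exp_add]
        · simp
      · intro p hp
        ext
        · simp [mul_assoc, ← Complex.exp_add]
        · simp
      · intro p hp
        exact ⟨trivial, (hsh _).1 hp.2⟩
      · intro p hp
        refine ⟨trivial, (hsh _).2 ?_⟩
        simpa using hp.2
    · intro p hp
      ext
      · simp [mul_assoc, ← Complex.exp_add]
      · simp
    · intro p hp
      ext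
      · simp [mul_assoc, ← Complex.exp_add]
      · simp
    · simp
    · intro p hp
      have c1 : DifferentiableAt ℂ (fun p : ℂ × ℂ => Q (e + p.2)) p :=
        (hQd (e + p.2)).comp p (differentiableAt_snd.const_add e)
      have c2 := c1.inv (hQ0 _ ((hsh _).1 hp.2))
      simp only [div_eq_mul_inv]
      exact (c2.const_mul (deriv P e)).differentiableWithinAt
    · intro p hp
      exact div_ne_zero he' (hQ0 _ ((hsh _).1 hp.2))
    · intro p hp
      rw [(hΨ p hp).fderiv, hΦ]
      have b1 := hQ0 _ ((hsh _).1 hp.2)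
      have b2 := hk _ ((hsh _).1 hp.2)
      ext
      · simp only [ContinuousLinearMap.prod_apply, ContinuousLinearMap.add_apply,
          ContinuousLinearMap.smul_apply, ContinuousLinearMap.coe_fst',
          ContinuousLinearMap.coe_snd', smul_eq_mul, Prod.smul_mk]
        rw [← mul_neg, b2]
        field_simp
        ring
      · simp only [ContinuousLinearMap.prod_apply, 
          ContinuousLinearMap.coe_snd', smul_eq_mul, Prod.smul_mk, hPQ]
        field_simp
        ring
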